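/- If b, b′ ∈ P(m,n) satisfy C(b) = C(b′), then b and b′ are P-equivalent. Equivalently, for every Catalan state C in the image of the map b ↦ C(b), the graph G(C) with vertex set 𝔟(C) and an edge joining b to P_i(b) whenever both lie in 𝔟(C) is connected. -/

import Mathlib

/-- `Pmn m n = {0, 1, …, n}^m`: integer sequences `b = (b₁, …, b_m)` with `0 ≤ bᵢ ≤ n`,
encoded as lists of length `m`. -/
def Pmn (m n : ℕ) : Set (List ℕ) := {b | b.length = m ∧ ∀ x ∈ b, x ≤ n}

/-- `Pmove n b b'` holds iff `b' = Pᵢ(b)` for some `1 ≤ i ≤ m − 1`: the move `Pᵢ` is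
defined on sequences with `bᵢ < b_{i+1} < n` by
`Pᵢ(b) = (b₁, …, b_{i-1}, b_{i+1}+1, bᵢ+1, b_{i+2}, …, b_m)`. -/
def Pmove (n : ℕ) (b b' : List ℕ) : Prop :=
  ∃ (u v : List ℕ) (x y : ℕ), x < y ∧ y < n ∧
    b = u ++ x :: y :: v ∧ b' = u ++ (y + 1) :: (x + 1) :: v

/-- Boundary points of `B(m,n)` (0-indexed): `ceil j` is the ceiling point `x_{j+1}`,
`floor j` is the floor point `x'_{j+1}`, `left i` is the left-side point `y_{i+1}`, and
`right i` is the right-side point `y'_{i+1}`. -/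
inductive Bpt : Type where
  | ceil : ℕ → Bpt
  | floor : ℕ → Bpt
  | left : ℕ → Bpt
  | right : ℕ → Bpt
deriving DecidableEq

/-- The new arc created by the first entry `b₁` of a sequence: `{y₁, x₁}` if `b₁ = 0`,
`{x_n, y'₁}` if `b₁ = n`, and `{x_{b₁}, x_{b₁+1}}` if `1 ≤ b₁ ≤ n − 1`. -/
def newPair (n b₁ : ℕ) : Sym2 Bpt :=
  if b₁ = 0 then s(Bpt.left 0, Bpt.ceil 0)
  else if b₁ = n then s(Bpt.ceil (n - 1), Bpt.right 0)
  else s(Bpt.ceil (b₁ - 1), Bpt.ceil b₁)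

/-- The relabeling map from the boundary points of `B(m-1,n)` into those of `B(m,n)`
determined by the first entry `b₁`: side points `ȳᵢ, ȳ'ᵢ` become `y_{i+1}, y'_{i+1}`;
floor points are unchanged; and the ceiling points `(x̄₁, …, x̄_n)` become
`(x₂, …, x_n, y'₁)` if `b₁ = 0`, `(y₁, x₁, …, x_{n-1})` if `b₁ = n`, and
`(y₁, x₁, …, x_{b₁-1}, x_{b₁+2}, …, x_n, y'₁)` if `1 ≤ b₁ ≤ n − 1`. -/
def relabel (n b₁ : ℕ) : Bpt → Bpt
  | .floor j => .floor j
  | .left i => .left (i + 1)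
  | .right i => .right (i + 1)
  | .ceil j =>
      if b₁ = 0 then (if j = n - 1 then .right 0 else .ceil (j + 1))
      else if j = 0 then .left 0
      else if j ≤ b₁ - 1 then .ceil (j - 1)
      else if j = n - 1 then .right 0
      else .ceil (j + 1)

/-- The Catalan state (perfect matching of the boundary points of `B(m,n)`)
realized by a sequence `b ∈ P(m,n)`, defined recursively: the empty sequence pairs
`x_j` with `x'_j` for all `j < n`; for `b = b₁ :: rest`, the matching of `rest` on
`B(m-1,n)` is transported along `relabel n b₁` and the new arc `newPair n b₁` is added. -/
def catState (n : ℕ) : List ℕ → Set (Sym2 Bpt)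
  | [] => {p | ∃ j < n, p = s(Bpt.ceil j, Bpt.floor j)}
  | b₁ :: rest => insert (newPair n b₁) (Sym2.map (relabel n b₁) '' catState n rest)

/-- The fiber `𝔟(C) = {b ∈ P(m,n) : C(b) = C}` of a Catalan state `C`. -/
def bSet (m n : ℕ) (C : Set (Sym2 Bpt)) : Set (List ℕ) :=
  {b ∈ Pmn m n | catState n b = C}

theorem relabel_injective (n d : ℕ) : Function.Injective (relabel n d) := by
  intro z w h
  cases z <;> cases w <;> simp only [relabel] at h <;> grind

theorem relabel_notMem_newPair {n d : ℕ} (hn : 1 ≤ n) (hd : d ≤ n) (z : Bpt) :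
    relabel n d z ∉ newPair n d := by
  cases z <;> simp only [relabel, newPair] <;> split_ifs <;> simp <;> omega

theorem map_relabel_newPair_of_lt {n x y : ℕ} (hxy : x < y) (hy : y < n) :
    Sym2.map (relabel n x) (newPair n y) = newPair n (y + 1) := by
  have h1 : y ≠ 0 := by omega
  have h2 : y ≠ n := by omega
  simp only [newPair, relabel, h1, h2, if_false, Sym2.map_mk]
  grind

theorem map_relabel_succ_newPair_succ {n x y : ℕ} (hxy : x < y) (hy : y < n) :
    Sym2.map (relabel n (y + 1)) (newPair n (x + 1)) = newPair n x := by
  have h1 : x + 1 ≠ n := by omega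
  rcases Nat.eq_zero_or_pos x with rfl | hx
  · have h2 : y ≠ 0 := by omega
    simp [newPair, relabel, h1, h2]
  · have h2 : x ≠ 0 := by omega
    have h3 : x ≠ n := by omega
    have h4 : x - 1 + 1 = x := by omega
    simp [newPair, relabel, h1, h2, h3]
    grind

theorem relabel_comp_relabel {n x y : ℕ} (hxy : x < y) (hy : y < n) (z : Bpt) :
    relabel n x (relabel n y z) = relabel n (y + 1) (relabel n (x + 1) z) := by
  cases z <;> simp only [relabel]
  split_ifs <;> grind

theorem newPair_injective (n : ℕ) : Function.Injective (newPair n) := by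
  intro c d h
  unfold newPair at h
  split_ifs at h <;> simp at h <;> omega

theorem Pmove.catState_eq {n : ℕ} {b b' : List ℕ} (h : Pmove n b b') :
    catState n b = catState n b' := by
  obtain ⟨u, v, x, y, hxy, hy, rfl, rfl⟩ := h
  induction u with
  | nil =>
    have hcomp : relabel n x ∘ relabel n y = relabel n (y + 1) ∘ relabel n (x + 1) :=
      funext (relabel_comp_relabel hxy hy)
    simp only [List.nil_append, catState, Set.image_insert_eq, Set.image_image, Sym2.map_map,
      map_relabel_newPair_of_lt hxy hy, map_relabel_succ_newPair_succ hxy hy, hcomp]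
    exact Set.insert_comm _ _ _
  | cons a u ih => simp only [List.cons_append, catState, ih]

theorem Pmove.mem_Pmn_iff {m n : ℕ} {b b' : List ℕ} (h : Pmove n b b') :
    b ∈ Pmn m n ↔ b' ∈ Pmn m n := by
  obtain ⟨u, v, x, y, hxy, hy, rfl, rfl⟩ := h
  have hx : x ≤ n := by omega
  have hx' : x + 1 ≤ n := by omega
  simp [Pmn, or_imp, forall_and, hx, hx', hy, hy.le]

theorem catState_eq_of_eqvGen {n : ℕ} {b b' : List ℕ} (h : Relation.EqvGen (Pmove n) b b') :
    catState n b = catState n b' := by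
  induction h with
  | rel _ _ h => exact h.catState_eq
  | refl _ => rfl
  | symm _ _ _ ih => exact ih.symm
  | trans _ _ _ _ _ ih₁ ih₂ => exact ih₁.trans ih₂

theorem mem_Pmn_iff_of_eqvGen {m n : ℕ} {b b' : List ℕ}
    (h : Relation.EqvGen (Pmove n) b b') : b ∈ Pmn m n ↔ b' ∈ Pmn m n := by
  induction h with
  | rel _ _ h => exact h.mem_Pmn_iff
  | refl _ => rfl
  | symm _ _ _ ih => exact ih.symm
  | trans _ _ _ _ _ ih₁ ih₂ => exact ih₁.trans ih₂

theorem Pmove.cons {n : ℕ} {b b' : List ℕ} (a : ℕ) (h : Pmove n b b') :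
    Pmove n (a :: b) (a :: b') := by
  obtain ⟨u, v, x, y, hxy, hy, rfl, rfl⟩ := h
  exact ⟨a :: u, v, x, y, hxy, hy, rfl, rfl⟩

theorem eqvGen_Pmove_cons {n : ℕ} {b b' : List ℕ} (a : ℕ)
    (h : Relation.EqvGen (Pmove n) b b') :
    Relation.EqvGen (Pmove n) (a :: b) (a :: b') := by
  induction h with
  | rel _ _ h => exact .rel _ _ (h.cons a)
  | refl _ => exact .refl _
  | symm _ _ _ ih => exact ih.symm
  | trans _ _ _ _ _ ih₁ ih₂ => exact ih₁.trans _ _ _ ih₂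

theorem cons_mem_Pmn_iff {m n a : ℕ} {b : List ℕ} :
    a :: b ∈ Pmn (m + 1) n ↔ a ≤ n ∧ b ∈ Pmn m n := by
  simp [Pmn, and_left_comm]

/-- Neighbouring new arcs share a ceiling point. -/
theorem exists_mem_newPair_of_succ {n c : ℕ} (hc : c < n) :
    ∃ z, z ∈ newPair n c ∧ z ∈ newPair n (c + 1) := by
  refine ⟨.ceil c, ?_, ?_⟩ <;> unfold newPair <;> split_ifs <;> simp <;> grind

theorem newPair_ne_map_relabel {n c d : ℕ} (hn : 1 ≤ n) (hd : d ≤ n) {z : Bpt}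
    (hzc : z ∈ newPair n c) (hzd : z ∈ newPair n d) (p : Sym2 Bpt) :
    Sym2.map (relabel n d) p ≠ newPair n c := by
  rintro h
  rw [← h, Sym2.mem_map] at hzc
  obtain ⟨w, -, rfl⟩ := hzc
  exact relabel_notMem_newPair hn hd w hzd

theorem newPair_notMem_image {n d : ℕ} (hn : 1 ≤ n) (hd : d ≤ n) (S : Set (Sym2 Bpt)) :
    newPair n d ∉ Sym2.map (relabel n d) '' S := by
  rintro ⟨p, -, hp⟩
  obtain ⟨z, hz⟩ : ∃ z, z ∈ newPair n d := ⟨_, Sym2.out_fst_mem _⟩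
  exact newPair_ne_map_relabel hn hd hz hz p hp

theorem catState_cons_cancel {n d : ℕ} (hn : 1 ≤ n) (hd : d ≤ n) {s t : List ℕ}
    (h : catState n (d :: s) = catState n (d :: t)) : catState n s = catState n t := by
  simp only [catState] at h
  refine (Sym2.map.injective (relabel_injective n d)).image_injective ?_
  have := congrArg (· \ {newPair n d}) h
  simpa only [Set.insert_sdiff_self_of_notMem (newPair_notMem_image hn hd _)] using this

/-- A sequence whose state contains the arc `newPair n c` is `P`-equivalent to one that
starts with `c`. -/
theorem exists_eqvGen_cons_of_newPair_mem {n : ℕ} (hn : 1 ≤ n) {b : List ℕ} {c : ℕ}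
    (hb : ∀ x ∈ b, x ≤ n) (hc : c ≤ n) (h : newPair n c ∈ catState n b) :
    ∃ s, Relation.EqvGen (Pmove n) b (c :: s) := by
  induction b generalizing c with
  | nil =>
    obtain ⟨j, -, hj⟩ := h
    unfold newPair at hj
    split_ifs at hj <;> simp at hj
  | cons d t ih =>
    have hd : d ≤ n := hb d (by simp)
    have ht : ∀ x ∈ t, x ≤ n := fun x hx => hb x (by simp [hx])
    have hinj := Sym2.map.injective (relabel_injective n d)
    rcases h with h | ⟨p, hp, hpc⟩
    · rw [newPair_injective n h]
      exact ⟨t, .refl _⟩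
    rcases lt_trichotomy c d with hcd | rfl | hcd
    · rcases Nat.lt_or_eq_of_le (Nat.succ_le_of_lt hcd) with hcd | rfl
      · obtain ⟨e, rfl⟩ : ∃ e, d = e + 1 := ⟨d - 1, by omega⟩
        have hce : c < e := by omega
        rw [← map_relabel_succ_newPair_succ hce hd] at hpc
        rw [hinj hpc] at hp
        obtain ⟨s, hs⟩ := ih ht (by omega) hp
        exact ⟨e :: s, (eqvGen_Pmove_cons _ hs).trans _ _ _
          (.symm _ _ (.rel _ _ ⟨[], s, c, e, hce, hd, rfl, rfl⟩))⟩
      · obtain ⟨z, hz₁, hz₂⟩ := exists_mem_newPair_of_succ (n := n) (c := c) hd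
        exact absurd hpc (newPair_ne_map_relabel hn hd hz₁ hz₂ p)
    · exact ⟨t, .refl _⟩
    · rcases Nat.lt_or_eq_of_le (Nat.succ_le_of_lt hcd) with hcd | rfl
      · obtain ⟨e, rfl⟩ : ∃ e, c = e + 1 := ⟨c - 1, by omega⟩
        have hde : d < e := by omega
        rw [← map_relabel_newPair_of_lt hde hc] at hpc
        rw [hinj hpc] at hp
        obtain ⟨s, hs⟩ := ih ht (by omega) hp
        exact ⟨(d + 1) :: s, (eqvGen_Pmove_cons _ hs).trans _ _ _
          (.rel _ _ ⟨[], s, d, e, hde, hc, rfl, rfl⟩)⟩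
      · obtain ⟨z, hz₁, hz₂⟩ := exists_mem_newPair_of_succ (n := n) (c := d) hc
        exact absurd hpc (newPair_ne_map_relabel hn hd hz₂ hz₁ p)

theorem eqvGen_Pmove_of_catState_eq {m n : ℕ} (hn : 1 ≤ n) {b b' : List ℕ}
    (hb : b ∈ Pmn m n) (hb' : b' ∈ Pmn m n) (h : catState n b = catState n b') :
    Relation.EqvGen (Pmove n) b b' := by
  induction m generalizing b b' with
  | zero =>
    rw [List.eq_nil_of_length_eq_zero hb.1, List.eq_nil_of_length_eq_zero hb'.1]
    exact .refl _
  | succ m ih =>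
    obtain ⟨c, r, rfl⟩ := List.exists_cons_of_length_eq_add_one hb'.1
    obtain ⟨hc, hr⟩ := cons_mem_Pmn_iff.1 hb'
    obtain ⟨s, hs⟩ := exists_eqvGen_cons_of_newPair_mem hn hb.2 hc
      (h ▸ Set.mem_insert _ _ : newPair n c ∈ catState n b)
    have hs' := (cons_mem_Pmn_iff.1 ((mem_Pmn_iff_of_eqvGen hs).1 hb)).2
    have hstate := catState_cons_cancel hn hc ((catState_eq_of_eqvGen hs).symm.trans h)
    exact hs.trans _ _ _ (eqvGen_Pmove_cons c (ih hs' hr hstate))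

/-- If `b, b' ∈ P(m,n)` realize the same Catalan state, i.e. `C(b) = C(b')`, then `b`
and `b'` are `P`-equivalent (related by the equivalence relation generated by the moves
`Pᵢ`); equivalently, for every Catalan state `C` in the image of `b ↦ C(b)`, the graph
`G(C)` on `𝔟(C)` with edges given by the moves `Pᵢ` is connected. -/
theorem catState_fiber_connected (m n : ℕ) (hm : 1 ≤ m) (hn : 1 ≤ n)
    (b b' : List ℕ) (hb : b ∈ Pmn m n) (hb' : b' ∈ Pmn m n)
    (h : catState n b = catState n b') :
    Relation.EqvGen (Pmove n) b b' :=
  eqvGen_Pmove_of_catState_eq hn hb hb' h
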